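/- arXiv:1107.2272 — 2 statements merged into one kernel-verified Lean document; each statement's English description precedes it below -/
import Mathlib

section
/- Let T be a tree on n vertices with diameter D = 4 whose central vertex u has at least three non-leaf neighbors, and let v₁,…,v_k be all neighbors of u labeled so that deg(v₁) ≤ … ≤ deg(v_k). If deg(v_k) − deg(v₁) ≤ 1 and deg(v_k) ≥ 4, then the tree T′ obtained from T by deleting two pendant neighbors of v_k and attaching a pendant path of length 2 to u satisfies ξ^ac(T) < ξ^ac(T′). -/
open Finset SimpleGraph

/-- Degree of a vertex `u`: the number of neighbors of `u`. -/
noncomputable def deg {V : Type*} [Fintype V] (G : SimpleGraph V) (u : V) : ℕ :=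
  {v | G.Adj u v}.ncard

/-- `M(u)`: the product of degrees of all neighbors of `u`. -/
noncomputable def Mprod {V : Type*} [Fintype V] (G : SimpleGraph V) (u : V) : ℕ :=
  ∏ᶠ v ∈ {v | G.Adj u v}, deg G v

/-- Eccentricity of a vertex `u`: the maximum distance from `u` to any vertex. -/
noncomputable def ecc {V : Type*} [Fintype V] (G : SimpleGraph V) (u : V) : ℕ :=
  Finset.univ.sup fun v => G.dist u v

/-- Diameter of a graph: the maximum distance between two vertices. -/
noncomputable def gdiam {V : Type*} [Fintype V] (G : SimpleGraph V) : ℕ :=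
  Finset.univ.sup fun u => ecc G u

/-- The augmented eccentric connectivity index `ξ^{ac}(G) = ∑_u M(u)/ε(u)`. -/
noncomputable def xiAC {V : Type*} [Fintype V] (G : SimpleGraph V) : ℝ :=
  ∑ u : V, (Mprod G u : ℝ) / (ecc G u : ℝ)

section Auxiliary

variable {V : Type*}

/-- `G` is a tree of height two with root `u` and parent map `p` (the root being its own parent),
in which the grandchildren of the root do not all descend from a single child. -/
structure IsHeightTwoTree (G : SimpleGraph V) (u : V) (p : V → V) : Prop where
  parent_parent : ∀ a, p (p a) = u
  adj_iff : ∀ a b, G.Adj a b ↔ a ≠ b ∧ (p a = b ∨ p b = a)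
  exists_grandchild : ∀ v, ∃ z, p z ≠ v ∧ p z ≠ u

/-- A function that varies by at most one along edges is `1`-Lipschitz for the graph distance. -/
lemma SimpleGraph.Connected.abs_sub_le_dist {G : SimpleGraph V} (hG : G.Connected) (f : V → ℤ)
    (hf : ∀ a b, G.Adj a b → |f a - f b| ≤ 1) (a b : V) : |f a - f b| ≤ G.dist a b := by
  obtain ⟨w, hw⟩ := hG.exists_walk_length_eq_dist a b
  rw [← hw]
  clear hw
  induction w with
  | nil => simp
  | cons h w ih =>
    rename_i x y z
    have h1 := hf _ _ h
    have h2 := abs_sub_le (f x) (f y) (f z)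
    simp only [Walk.length_cons]
    push_cast
    linarith

/-- In a tree, the neighbor of `x` closer to `u` is unique. -/
lemma SimpleGraph.IsTree.eq_of_adj_of_dist_lt {G : SimpleGraph V} (hG : G.IsTree) {u x b c : V}
    (hb : G.Adj b x) (hc : G.Adj c x) (hbd : G.dist u b < G.dist u x)
    (hcd : G.dist u c < G.dist u x) : b = c := by
  have path : ∀ d, G.Adj d x → G.dist u d < G.dist u x →
      ∃ p : G.Walk u x, p.IsPath ∧ p.penultimate = d := by
    intro d hd hlt
    obtain ⟨p, hp⟩ := hG.connected.exists_walk_length_eq_dist u d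
    refine ⟨p.concat hd, Walk.isPath_of_length_eq_dist _ ?_, by simp⟩
    have := hG.dist_eq_dist_add_one_of_adj u hd
    rw [Walk.length_concat]
    omega
  obtain ⟨p, hp, rfl⟩ := path b hb hbd
  obtain ⟨q, hq, rfl⟩ := path c hc hcd
  rw [(hG.existsUnique_path u x).unique hp hq]

namespace IsHeightTwoTree

variable {G : SimpleGraph V} {u : V} {p : V → V}

lemma parent_root (h : IsHeightTwoTree G u p) : p u = u := by
  have h1 := h.parent_parent (p u)
  rwa [h.parent_parent u] at h1

lemma parent_ne (h : IsHeightTwoTree G u p) {v : V} (hv : v ≠ u) : p v ≠ v := by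
  intro h1
  have := h.parent_parent v
  rw [h1, h1] at this
  exact hv this

lemma adj_parent (h : IsHeightTwoTree G u p) {v : V} (hv : v ≠ u) : G.Adj v (p v) :=
  (h.adj_iff _ _).2 ⟨(h.parent_ne hv).symm, Or.inl rfl⟩

lemma adj_root_iff (h : IsHeightTwoTree G u p) {v : V} : G.Adj u v ↔ v ≠ u ∧ p v = u := by
  rw [h.adj_iff, h.parent_root]
  grind

lemma adj_child_iff (h : IsHeightTwoTree G u p) {v x : V} (hv : v ≠ u) (hpv : p v = u) :
    G.Adj v x ↔ x = u ∨ p x = v := by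
  rw [h.adj_iff, hpv]
  have := h.parent_root
  grind

lemma adj_grandchild_iff (h : IsHeightTwoTree G u p) {z x : V} (hz : p z ≠ u) :
    G.Adj z x ↔ x = p z := by
  rw [h.adj_iff]
  have := h.parent_root
  have := h.parent_parent x
  have := h.parent_parent z
  grind

lemma connected (h : IsHeightTwoTree G u p) : G.Connected := by
  rw [connected_iff_exists_forall_reachable]
  refine ⟨u, fun v => ?_⟩
  by_cases hv : v = u
  · rw [hv]
  by_cases hp : p v = u
  · exact (hp ▸ h.adj_parent hv).symm.reachable
  · have h1 := h.adj_parent hp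
    rw [h.parent_parent] at h1
    exact h1.symm.reachable.trans (h.adj_parent hv).symm.reachable

open Classical in
lemma dist_root (h : IsHeightTwoTree G u p) (v : V) :
    G.dist v u ≤ if v = u then 0 else if p v = u then 1 else 2 := by
  split_ifs with hv hp
  · simp [hv]
  · exact (dist_eq_one_iff_adj.2 (hp ▸ h.adj_parent hv)).le
  · have h1 := h.adj_parent hp
    rw [h.parent_parent] at h1
    exact dist_le (Walk.cons (h.adj_parent hv) (Walk.cons h1 Walk.nil))

open Classical in
lemma ecc_eq [Fintype V] (h : IsHeightTwoTree G u p) (v : V) :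
    ecc G v = if v = u then 2 else if p v = u then 3 else 4 := by
  apply le_antisymm
  · refine Finset.sup_le fun x _ => ?_
    have h1 := h.dist_root v
    have h2 := h.dist_root x
    have h3 := h.connected.dist_triangle (u := v) (v := u) (w := x)
    rw [G.dist_comm (u := u)] at h3
    grind
  · set c := if p v = u then v else p v with hc
    obtain ⟨z, hz, hzu⟩ := h.exists_grandchild c
    refine le_trans ?_ (Finset.le_sup (Finset.mem_univ z))
    let f : V → ℤ := fun x =>
      if x = u then 0 else if p x = u then (if x = c then 1 else -1) else
        if p x = c then 2 else -2
    have hf : ∀ a b, G.Adj a b → |f a - f b| ≤ 1 := by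
      have key : ∀ a, |f a - f (p a)| ≤ 1 := by
        intro a
        have h1 := h.parent_parent a
        have h2 := h.parent_root
        rw [abs_le]
        simp only [f]
        grind
      intro a b hab
      rcases ((h.adj_iff a b).1 hab).2 with rfl | rfl
      · exact key a
      · rw [abs_sub_comm]
        exact key b
    have h1 := (le_abs_self _).trans (h.connected.abs_sub_le_dist f hf v z)
    have hzr : z ≠ u := by
      rintro rfl
      exact hzu h.parent_root
    have hfz : f z = -2 := by simp [f, hzr, hzu, hz]
    rw [hfz] at h1
    have hp := h.parent_parent v
    simp only [f, hc] at h1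
    split_ifs at h1 ⊢ <;> first | omega | simp_all

open Classical in
lemma deg_root [Fintype V] (h : IsHeightTwoTree G u p) :
    deg G u = #{v | v ≠ u ∧ p v = u} := by
  rw [deg, ← Set.ncard_coe_finset]
  congr 1
  ext x
  simp [h.adj_root_iff]

open Classical in
lemma deg_child [Fintype V] (h : IsHeightTwoTree G u p) {v : V} (hv : v ≠ u) (hpv : p v = u) :
    deg G v = #{x | p x = v} + 1 := by
  have h1 : u ∉ ({x | p x = v} : Finset V) := by
    simp [h.parent_root, hv.symm]
  rw [deg, ← Finset.card_insert_of_notMem h1, ← Set.ncard_coe_finset]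
  congr 1
  ext x
  simp [h.adj_child_iff hv hpv]

lemma deg_grandchild [Fintype V] (h : IsHeightTwoTree G u p) {z : V} (hz : p z ≠ u) :
    deg G z = 1 := by
  have : {x | G.Adj z x} = {p z} := by
    ext x
    simp [h.adj_grandchild_iff hz]
  rw [deg, this, Set.ncard_singleton]

open Classical in
lemma Mprod_root [Fintype V] (h : IsHeightTwoTree G u p) :
    Mprod G u = ∏ v with v ≠ u ∧ p v = u, deg G v := by
  rw [Mprod, ← finprod_mem_coe_finset]
  congr! 3
  simp [h.adj_root_iff]

open Classical in
lemma Mprod_child [Fintype V] (h : IsHeightTwoTree G u p) {v : V} (hv : v ≠ u) (hpv : p v = u) :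
    Mprod G v = #{v | v ≠ u ∧ p v = u} := by
  have h1 : u ∉ ({x | p x = v} : Finset V) := by
    simp [h.parent_root, hv.symm]
  have h2 : {x | G.Adj v x} = (insert u ({x | p x = v} : Finset V) : Finset V) := by
    ext x
    simp [h.adj_child_iff hv hpv]
  rw [Mprod, h2, finprod_mem_coe_finset, Finset.prod_insert h1, h.deg_root,
    Finset.prod_eq_one, mul_one]
  intro x hx
  refine h.deg_grandchild ?_
  simp_all

lemma Mprod_grandchild [Fintype V] (h : IsHeightTwoTree G u p) {z : V} (hz : p z ≠ u) :
    Mprod G z = deg G (p z) := by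
  have : {x | G.Adj z x} = {p z} := by
    ext x
    simp [h.adj_grandchild_iff hz]
  rw [Mprod, this, finprod_mem_singleton]

open Classical in
lemma xiAC_eq [Fintype V] (h : IsHeightTwoTree G u p) :
    xiAC G = (∏ v with v ≠ u ∧ p v = u, (deg G v : ℝ)) / 2
      + (#{v | v ≠ u ∧ p v = u} : ℝ) ^ 2 / 3
      + ∑ v with v ≠ u ∧ p v = u, ((deg G v : ℝ) - 1) * deg G v / 4 := by
  have hu : ({v | p v = u} : Finset V) = insert u ({v | v ≠ u ∧ p v = u} : Finset V) := by
    ext x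
    have := h.parent_root
    simp only [mem_filter, mem_univ, true_and, mem_insert]
    grind
  have hu' : u ∉ ({v | v ≠ u ∧ p v = u} : Finset V) := by simp
  rw [xiAC, ← Finset.sum_filter_add_sum_filter_not univ (fun v => p v = u), hu,
    Finset.sum_insert hu']
  congr 1
  · congr 1
    · rw [h.ecc_eq, h.Mprod_root]
      simp
    · rw [Finset.sum_congr rfl (g := fun _ => (#{v | v ≠ u ∧ p v = u} : ℝ) / 3)]
      · rw [Finset.sum_const, nsmul_eq_mul]
        ring
      · intro v hv
        simp only [mem_filter, mem_univ, true_and] at hv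
        rw [h.ecc_eq, h.Mprod_child hv.1 hv.2]
        simp [hv.1, hv.2]
  · have hm : ∀ z ∈ ({z | ¬ p z = u} : Finset V), p z ∈ ({v | v ≠ u ∧ p v = u} : Finset V) := by
      intro z hz
      have := h.parent_parent z
      simp_all
    rw [← Finset.sum_fiberwise_of_maps_to hm]
    refine Finset.sum_congr rfl fun v hv => ?_
    simp only [mem_filter, mem_univ, true_and] at hv
    rw [Finset.sum_congr rfl (g := fun _ => (deg G v : ℝ) / 4)]
    · rw [Finset.sum_const, nsmul_eq_mul, h.deg_child hv.1 hv.2]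
      have : ({z | ¬ p z = u} : Finset V).filter (fun z => p z = v) =
          ({z | p z = v} : Finset V) := by
        ext z
        simp only [mem_filter, mem_univ, true_and]
        grind
      rw [this]
      push_cast
      ring
    · intro z hz
      simp only [mem_filter, mem_univ, true_and] at hz
      have hzu : z ≠ u := by
        rintro rfl
        exact hz.1 h.parent_root
      rw [h.ecc_eq, h.Mprod_grandchild hz.1, if_neg hzu, if_neg hz.1, hz.2]
      norm_num

end IsHeightTwoTree

lemma exists_adj_ne_of_deg_ne_one [Fintype V] {G : SimpleGraph V} {u v : V} (huv : G.Adj u v)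
    (hv : deg G v ≠ 1) : ∃ y, G.Adj v y ∧ y ≠ u := by
  by_contra! hy
  refine hv ?_
  have : {x | G.Adj v x} = {u} := by
    ext x
    exact ⟨hy x, by rintro rfl; exact huv.symm⟩
  rw [deg, this, Set.ncard_singleton]

lemma dist_le_gdiam [Fintype V] (G : SimpleGraph V) (a b : V) : G.dist a b ≤ gdiam G :=
  (Finset.le_sup (f := fun v => G.dist a v) (Finset.mem_univ b)).trans
    (Finset.le_sup (f := fun v => ecc G v) (Finset.mem_univ a))

/-- In a tree of diameter at most four, a vertex with two non-leaf neighbors has eccentricity at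
most two. -/
lemma SimpleGraph.IsTree.dist_le_two_of_gdiam_le_four [Fintype V] {G : SimpleGraph V}
    (hG : G.IsTree) (hdiam : gdiam G ≤ 4) {u : V}
    (hu : 1 < {v | G.Adj u v ∧ deg G v ≠ 1}.ncard) (x : V) : G.dist u x ≤ 2 := by
  by_contra! hx
  rw [G.dist_comm] at hx
  obtain ⟨v, huv, hv, hxv⟩ : ∃ v, G.Adj u v ∧ deg G v ≠ 1 ∧ G.dist x u < G.dist x v := by
    by_contra! hcon
    obtain ⟨a, ⟨ha, ha'⟩, b, ⟨hb, hb'⟩, hab⟩ := (Set.one_lt_ncard (Set.toFinite _)).1 hu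
    refine hab (hG.eq_of_adj_of_dist_lt ha.symm hb.symm ((hcon a ha ha').lt_of_ne ?_)
      ((hcon b hb hb').lt_of_ne ?_))
    · exact (hG.dist_ne_of_adj x ha).symm
    · exact (hG.dist_ne_of_adj x hb).symm
  obtain ⟨y, hvy, hyu⟩ := exists_adj_ne_of_deg_ne_one huv hv
  have hxy : G.dist x v < G.dist x y := by
    by_contra! hcon
    exact hyu (hG.eq_of_adj_of_dist_lt hvy.symm huv
      (hcon.lt_of_ne (hG.dist_ne_of_adj x hvy).symm) hxv)
  have := dist_le_gdiam G x y
  omega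

/-- The parent map of a tree rooted at `u`. -/
lemma SimpleGraph.IsTree.exists_parent {G : SimpleGraph V} (hG : G.IsTree) (u : V) :
    ∃ p : V → V, (∀ a, G.dist u (p a) = G.dist u a - 1) ∧
      ∀ a b, G.Adj a b ↔ a ≠ b ∧ (p a = b ∨ p b = a) := by
  have hex : ∀ a, ∃ b, G.dist u b = G.dist u a - 1 ∧ (a ≠ u → G.Adj b a) := by
    intro a
    by_cases ha : a = u
    · exact ⟨u, by simp [ha]⟩
    obtain ⟨w, hw⟩ := hG.connected.exists_walk_length_eq_dist a u
    cases w with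
    | nil => exact absurd rfl ha
    | @cons _ b _ h w =>
      refine ⟨b, ?_, fun _ => h.symm⟩
      have h1 := dist_le w
      have h2 := hG.dist_eq_dist_add_one_of_adj u h
      rw [Walk.length_cons, G.dist_comm] at hw
      rw [G.dist_comm] at h1
      omega
  choose p hp hadj using hex
  have hroot : ∀ a, p a ≠ a → a ≠ u := by
    rintro a h1 rfl
    have := hp a
    rw [dist_self, hG.connected.dist_eq_zero_iff] at this
    exact h1 this.symm
  have hpar : ∀ a b, G.Adj a b → G.dist u a < G.dist u b → p b = a := by
    intro a b hab hlt
    have hbu : b ≠ u := by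
      rintro rfl
      simp at hlt
    exact hG.eq_of_adj_of_dist_lt (hadj b hbu) hab (by rw [hp]; omega) hlt
  refine ⟨p, hp, fun a b => ⟨fun hab => ⟨hab.ne, ?_⟩, ?_⟩⟩
  · rcases (hG.dist_ne_of_adj u hab).lt_or_gt with hlt | hlt
    · exact Or.inr (hpar a b hab hlt)
    · exact Or.inl (hpar b a hab.symm hlt)
  · rintro ⟨hne, rfl | rfl⟩
    · exact (hadj a (hroot a hne.symm)).symm
    · exact hadj b (hroot b hne)

/-- A tree of diameter at most four is a tree of height two when rooted at a vertex with two
non-leaf neighbors. -/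
lemma SimpleGraph.IsTree.exists_isHeightTwoTree [Fintype V] {G : SimpleGraph V}
    (hG : G.IsTree) (hdiam : gdiam G ≤ 4) {u : V}
    (hu : 1 < {v | G.Adj u v ∧ deg G v ≠ 1}.ncard) : ∃ p, IsHeightTwoTree G u p := by
  obtain ⟨p, hp, hadj⟩ := hG.exists_parent u
  have hpp : ∀ a, p (p a) = u := by
    intro a
    have h1 := hG.dist_le_two_of_gdiam_le_four hdiam hu a
    have h2 := hp (p a)
    rw [hp a, show G.dist u a - 1 - 1 = 0 by omega, hG.connected.dist_eq_zero_iff] at h2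
    exact h2.symm
  refine ⟨p, hpp, hadj, fun v => ?_⟩
  obtain ⟨c, ⟨huc, hc⟩, hcv⟩ := Set.exists_ne_of_one_lt_ncard hu v
  obtain ⟨z, hcz, hzu⟩ := exists_adj_ne_of_deg_ne_one huc hc
  have h1 := hpp u
  have h2 := hpp c
  have h3 := hpp (p u)
  have h4 := (hadj _ _).1 huc
  have h5 := (hadj _ _).1 hcz
  exact ⟨z, by grind, by grind⟩

namespace IsHeightTwoTree

open Classical in
/-- Detaching two children `w₁`, `w₂` of `c` and attaching the path `u - w₁ - w₂` to the root
gives a tree of height two. -/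
lemma move_path {G : SimpleGraph V} {u : V} {p : V → V} (h : IsHeightTwoTree G u p)
    {c w₁ w₂ : V} (hc : c ≠ u) (hw : w₁ ≠ w₂) (h₁ : p w₁ = c) (h₂ : p w₂ = c) :
    IsHeightTwoTree
      (fromEdgeSet ((G.edgeSet \ {s(c, w₁), s(c, w₂)}) ∪ {s(u, w₁), s(w₁, w₂)})) u
      (Function.update (Function.update p w₁ u) w₂ w₁) := by
  have hu := h.parent_root
  have hpp := h.parent_parent
  refine ⟨fun a => ?_, fun a b => ?_, fun v => ?_⟩
  · have := hpp a
    simp only [Function.update_apply]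
    grind
  · have ha := hpp a
    have hb := hpp b
    have hpw := hpp w₁
    simp only [fromEdgeSet_adj, Set.mem_union, Set.mem_sdiff, mem_edgeSet, h.adj_iff,
      Set.mem_insert_iff, Set.mem_singleton_iff, Sym2.eq_iff, Function.update_apply]
    grind
  · have hpw := hpp w₁
    by_cases hv : v = w₁
    · obtain ⟨z, hz, hzu⟩ := h.exists_grandchild c
      refine ⟨z, ?_, ?_⟩ <;> have := hpp z <;> simp only [Function.update_apply] <;> grind
    · refine ⟨w₂, ?_, ?_⟩ <;> simp only [Function.update_apply] <;> grind

end IsHeightTwoTree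

end Auxiliary

/-- Lemma: Let `T` be a tree of diameter 4 whose central vertex `u` has at least three
non-leaf neighbors, let `v₁` be a neighbor of `u` of minimum degree and `vₖ` a neighbor
of maximum degree. If `deg(vₖ) - deg(v₁) ≤ 1` and `deg(vₖ) ≥ 4`, the tree `T'` obtained
by deleting two pendant neighbors `w₁, w₂` of `vₖ` and attaching the pendant path
`u - w₁ - w₂` to `u` satisfies `ξ^{ac}(T) < ξ^{ac}(T')`. -/
theorem xiAC_pendant_path_step {V : Type*} [Fintype V] (T : SimpleGraph V)
    (hT : T.IsTree) (hdiam : gdiam T = 4)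
    (u : V) (hcentral : ∀ v, ecc T u ≤ ecc T v)
    (hnonleaf : 3 ≤ {v | T.Adj u v ∧ deg T v ≠ 1}.ncard)
    (v1 vk : V) (hv1 : T.Adj u v1) (hvk : T.Adj u vk)
    (hmin : ∀ v, T.Adj u v → deg T v1 ≤ deg T v)
    (hmax : ∀ v, T.Adj u v → deg T v ≤ deg T vk)
    (hgap : deg T vk ≤ deg T v1 + 1) (hvk4 : 4 ≤ deg T vk)
    (w1 w2 : V) (hne : w1 ≠ w2)
    (hw1 : T.Adj vk w1) (hw2 : T.Adj vk w2)
    (hw1leaf : deg T w1 = 1) (hw2leaf : deg T w2 = 1)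
    (T' : SimpleGraph V)
    (hT' : T' = fromEdgeSet
      ((T.edgeSet \ {s(vk, w1), s(vk, w2)}) ∪ {s(u, w1), s(w1, w2)})) :
    xiAC T < xiAC T' := by
    classical
  obtain ⟨p, h⟩ := hT.exists_isHeightTwoTree hdiam.le (u := u) (by omega)
  obtain ⟨hku, hpk⟩ := h.adj_root_iff.1 hvk
  have hpu := h.parent_root
  have hdegu : 3 ≤ deg T u :=
    hnonleaf.trans (Set.ncard_le_ncard (fun x hx => hx.1) (Set.toFinite _))
  have hw1u : w1 ≠ u := by
    rintro rfl
    omega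
  have hw2u : w2 ≠ u := by
    rintro rfl
    omega
  have hp1 : p w1 = vk := by
    simpa [hw1u] using (h.adj_child_iff hku hpk).1 hw1
  have hp2 : p w2 = vk := by
    simpa [hw2u] using (h.adj_child_iff hku hpk).1 hw2
  have hnochild : ∀ x, p x ≠ w1 ∧ p x ≠ w2 := by
    intro x
    have := h.parent_parent x
    grind
  have h' := h.move_path hku hne hp1 hp2
  rw [← hT'] at h'
  set q := Function.update (Function.update p w1 u) w2 w1 with hq
  set N : Finset V := {v | (v ≠ u ∧ p v = u) ∧ v ≠ vk} with hN
  have hkN : vk ∉ N := by simp [hN]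
  have h1N : w1 ∉ insert vk N := by simp [hN, hp1, hku, hw1.ne']
  have hNT : ({v | v ≠ u ∧ p v = u} : Finset V) = insert vk N := by
    ext x
    simp only [hN, mem_filter, mem_univ, true_and, mem_insert]
    grind
  have hNT' : ({v | v ≠ u ∧ q v = u} : Finset V) = insert w1 (insert vk N) := by
    ext x
    simp only [hN, hq, Function.update_apply, mem_filter, mem_univ, true_and, mem_insert]
    grind
  have hdegN : ∀ v ∈ N, deg T' v = deg T v := by
    intro v hv
    simp only [hN, mem_filter, mem_univ, true_and] at hv
    have hv' : v ∈ ({v | v ≠ u ∧ q v = u} : Finset V) := by simp [hNT', hN, hv]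
    simp only [mem_filter, mem_univ, true_and] at hv'
    rw [h.deg_child hv.1.1 hv.1.2, h'.deg_child hv'.1 hv'.2]
    congr 2
    ext x
    simp only [hq, Function.update_apply, mem_filter, mem_univ, true_and]
    grind
  have hdegk : deg T vk = deg T' vk + 2 := by
    have hv' : vk ∈ ({v | v ≠ u ∧ q v = u} : Finset V) := by simp [hNT']
    simp only [mem_filter, mem_univ, true_and] at hv'
    rw [h.deg_child hku hpk, h'.deg_child hv'.1 hv'.2]
    have : ({x | p x = vk} : Finset V) = insert w1 (insert w2 ({x | q x = vk} : Finset V)) := by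
      ext x
      simp only [hq, Function.update_apply, mem_filter, mem_univ, true_and, mem_insert]
      grind
    rw [this, Finset.card_insert_of_notMem, Finset.card_insert_of_notMem]
    · simp [hq, hw1.ne']
    · simp [hq, Function.update_apply, hne, hku.symm]
  have hdeg1 : deg T' w1 = 2 := by
    have hv' : w1 ∈ ({v | v ≠ u ∧ q v = u} : Finset V) := by simp [hNT']
    simp only [mem_filter, mem_univ, true_and] at hv'
    rw [h'.deg_child hv'.1 hv'.2]
    have : ({x | q x = w1} : Finset V) = {w2} := by
      ext x
      simp only [hq, Function.update_apply, mem_filter, mem_univ, true_and, mem_singleton]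
      grind
    rw [this, Finset.card_singleton]
  have hcard : 2 ≤ #N := by
    rw [h.deg_root, hNT, Finset.card_insert_of_notMem hkN] at hdegu
    omega
  have hprod : (9 : ℝ) ≤ ∏ v ∈ N, (deg T v : ℝ) := by
    calc (9 : ℝ) = 3 ^ 2 := by norm_num
      _ ≤ 3 ^ #N := pow_le_pow_right₀ (by norm_num) hcard
      _ = ∏ v ∈ N, (3 : ℝ) := by rw [Finset.prod_const]
      _ ≤ ∏ v ∈ N, (deg T v : ℝ) := by
        refine Finset.prod_le_prod (fun _ _ => by norm_num) fun v hv => ?_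
        simp only [hN, mem_filter, mem_univ, true_and] at hv
        have := hmin v (h.adj_root_iff.2 hv.1)
        exact_mod_cast (by omega : 3 ≤ deg T v)
  have hprodN : ∏ v ∈ N, (deg T' v : ℝ) = ∏ v ∈ N, (deg T v : ℝ) :=
    Finset.prod_congr rfl fun v hv => by rw [hdegN v hv]
  have hsumN : ∑ v ∈ N, ((deg T' v : ℝ) - 1) * deg T' v / 4 =
      ∑ v ∈ N, ((deg T v : ℝ) - 1) * deg T v / 4 :=
    Finset.sum_congr rfl fun v hv => by rw [hdegN v hv]
  rw [h.xiAC_eq, h'.xiAC_eq, hNT, hNT', Finset.prod_insert h1N, Finset.sum_insert h1N,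
    Finset.card_insert_of_notMem h1N, Finset.prod_insert hkN, Finset.prod_insert hkN,
    Finset.sum_insert hkN, Finset.sum_insert hkN, Finset.card_insert_of_notMem hkN,
    hprodN, hsumN, hdeg1, hdegk]
  have hd : (2 : ℝ) ≤ deg T' vk := by exact_mod_cast (by omega : 2 ≤ deg T' vk)
  have hc : (2 : ℝ) ≤ #N := by exact_mod_cast hcard
  push_cast
  nlinarith [mul_nonneg (sub_nonneg.2 hprod) (sub_nonneg.2 hd)]
end

section
/- Let T = TB_{n,k} be a degree balanced tree on n vertices with diameter 4 whose central vertex has at least three non-leaf neighbors, and suppose ⌈(n−1)/k⌉ = 3. Then ξ^ac(T) ≤ ξ^ac(TB_{n,⌈(n−1)/3⌉}), with equality if and only if k = ⌈(n−1)/3⌉. -/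
open Finset SimpleGraph

/-- Ceiling division of naturals: `⌈a / b⌉`. -/
def ceilDiv (a b : ℕ) : ℕ := (a + b - 1) / b

/-- `T` is (isomorphic to) the degree balanced tree `TB_{n,k}`: a tree on `n` vertices of
diameter 4 whose central vertex has degree `k` and in which the degrees of any two
neighbors of the central vertex differ by at most one. -/
def IsTB {V : Type*} [Fintype V] (T : SimpleGraph V) (n k : ℕ) : Prop :=
  T.IsTree ∧ Fintype.card V = n ∧ gdiam T = 4 ∧
  ∃ c : V, (∀ v, ecc T c ≤ ecc T v) ∧ deg T c = k ∧
    ∀ v w, T.Adj c v → T.Adj c w → deg T v ≤ deg T w + 1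

lemma deg_eq_card {V : Type*} [Fintype V] (G : SimpleGraph V) [DecidableRel G.Adj] (u : V) :
    deg G u = #(G.neighborFinset u) := by
  rw [deg, ← Set.ncard_coe_finset]
  congr 1
  ext v
  simp

lemma Mprod_eq_prod {V : Type*} [Fintype V] (G : SimpleGraph V) [DecidableRel G.Adj] (u : V) :
    Mprod G u = ∏ v ∈ G.neighborFinset u, deg G v := by
  rw [Mprod, ← finprod_mem_coe_finset]
  congr 1
  ext v
  simp

lemma dist_le_ecc {V : Type*} [Fintype V] (G : SimpleGraph V) (u v : V) : G.dist u v ≤ ecc G u :=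
  Finset.le_sup (f := fun v => G.dist u v) (Finset.mem_univ v)

lemma ecc_le_gdiam {V : Type*} [Fintype V] (G : SimpleGraph V) (u : V) : ecc G u ≤ gdiam G :=
  Finset.le_sup (f := fun v => ecc G v) (Finset.mem_univ u)

lemma exists_dist_eq_gdiam {V : Type*} [Fintype V] [Nonempty V] (G : SimpleGraph V) :
    ∃ u v, G.dist u v = gdiam G := by
  obtain ⟨u, -, hu⟩ := Finset.exists_mem_eq_sup univ univ_nonempty (fun u => ecc G u)
  obtain ⟨v, -, hv⟩ := Finset.exists_mem_eq_sup univ univ_nonempty (fun v => G.dist u v)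
  exact ⟨u, v, by rw [gdiam, hu, ecc, hv]⟩

namespace SimpleGraph

variable {V : Type*} {T : SimpleGraph V}

/-- In a tree, a vertex has at most one neighbor closer to a given root. -/
lemma IsTree.eq_of_dist_add_one_eq (hT : T.IsTree) {u v x y : V} (hx : T.Adj x v)
    (hy : T.Adj y v) (hdx : T.dist u x + 1 = T.dist u v) (hdy : T.dist u y + 1 = T.dist u v) :
    x = y := by
  obtain ⟨p, hp⟩ := hT.connected.exists_walk_length_eq_dist u x
  obtain ⟨q, hq⟩ := hT.connected.exists_walk_length_eq_dist u y
  have hp' : (p.concat hx).IsPath := Walk.isPath_of_length_eq_dist _ (by simp [hp, hdx])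
  have hq' : (q.concat hy).IsPath := Walk.isPath_of_length_eq_dist _ (by simp [hq, hdy])
  have h := (hT.existsUnique_path u v).unique hp' hq'
  simpa using congrArg Walk.penultimate h

/-- In a tree, a step away from the root is followed by another unless one backtracks. -/
lemma IsTree.dist_eq_add_one_of_ne (hT : T.IsTree) {u a b d : V} (hab : T.Adj a b)
    (hbd : T.Adj b d) (hne : d ≠ a) (h : T.dist u b = T.dist u a + 1) :
    T.dist u d = T.dist u b + 1 := by
  rcases hT.dist_eq_dist_add_one_of_adj u hbd with h' | h'
  · exact absurd (hT.eq_of_dist_add_one_eq hbd.symm hab h'.symm h.symm) hne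
  · exact h'

lemma Connected.exists_adj_dist_eq (hT : T.Connected) {u v : V} {m : ℕ}
    (h : T.dist u v = m + 1) : ∃ x, T.Adj x v ∧ T.dist u x = m := by
  obtain ⟨p, hp⟩ := hT.exists_walk_length_eq_dist v u
  rw [dist_comm, h] at hp
  cases p with
  | nil => simp at hp
  | @cons _ x _ hadj q =>
    refine ⟨x, hadj.symm, ?_⟩
    have h1 : T.dist u x ≤ m := by
      rw [dist_comm]
      have := dist_le q
      rw [Walk.length_cons] at hp
      omega
    have h2 := hT.dist_triangle (u := u) (v := x) (w := v)
    rw [dist_eq_one_iff_adj.2 hadj.symm] at h2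
    omega

lemma IsTree.exists_ecc_le_two [Fintype V] (hT : T.IsTree) (hd : gdiam T = 4) :
    ∃ m, ecc T m ≤ 2 := by
  have := hT.connected.nonempty
  obtain ⟨u, w, huw⟩ := exists_dist_eq_gdiam T
  rw [hd] at huw
  obtain ⟨y, hyw, hy⟩ := hT.connected.exists_adj_dist_eq huw
  obtain ⟨m, hmy, hm⟩ := hT.connected.exists_adj_dist_eq hy
  obtain ⟨x, hxm, hx⟩ := hT.connected.exists_adj_dist_eq hm
  refine ⟨m, Finset.sup_le fun z _ => ?_⟩
  rw [dist_comm]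
  have hzu := (dist_le_ecc T z u).trans (ecc_le_gdiam T z)
  have hzw := (dist_le_ecc T z w).trans (ecc_le_gdiam T z)
  rcases hT.dist_eq_dist_add_one_of_adj z hxm with h1 | h1
  · have := hT.dist_eq_add_one_of_ne hxm.symm (dist_eq_one_iff_adj.1 hx).symm
      (by rintro rfl; simp at hm) h1
    omega
  · have hxy : y ≠ x := by rintro rfl; omega
    have h2 := hT.dist_eq_add_one_of_ne hxm hmy hxy h1
    have h3 := hT.dist_eq_add_one_of_ne hmy hyw (by rintro rfl; omega) h2
    omega

section Center

variable [Fintype V] [DecidableEq V] [DecidableRel T.Adj] {c : V}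

lemma IsTree.sum_univ_of_dist_le_two (hT : T.IsTree) (hc : ∀ v, T.dist c v ≤ 2)
    (f : V → ℝ) :
    ∑ v, f v = f c + (∑ v ∈ T.neighborFinset c, f v +
      ∑ v ∈ T.neighborFinset c, ∑ w ∈ (T.neighborFinset v).erase c, f w) := by
  have hdist : ∀ v w, T.Adj c v → T.Adj v w → w ≠ c → T.dist c w = 2 := by
    intro v w hv hw hwc
    have := hT.dist_eq_add_one_of_ne (u := c) hv hw hwc (by simpa using hv)
    rw [this, dist_eq_one_iff_adj.2 hv]
  have huniv : (univ : Finset V) = insert c (T.neighborFinset c ∪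
      (T.neighborFinset c).biUnion fun v => (T.neighborFinset v).erase c) := by
    ext w
    simp only [mem_univ, mem_insert, mem_union, mem_neighborFinset, mem_biUnion, mem_erase,
      true_iff]
    by_cases h0 : w = c
    · exact Or.inl h0
    refine Or.inr ?_
    have hpos := hT.connected.pos_dist_of_ne (Ne.symm h0)
    have hle := hc w
    by_cases h1 : T.dist c w = 1
    · exact Or.inl (by simpa using h1)
    · obtain ⟨v, hv, hv1⟩ := hT.connected.exists_adj_dist_eq (show T.dist c w = 1 + 1 by omega)
      exact Or.inr ⟨v, by simpa using hv1, h0, hv⟩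
  rw [huniv, sum_insert, sum_union, sum_biUnion]
  · intro v hv v' hv' hne
    rw [Function.onFun, Finset.disjoint_left]
    intro w hw hw'
    simp only [coe_neighborFinset, mem_neighborSet, mem_erase, mem_neighborFinset] at hv hv' hw hw'
    have h2 := hdist v w hv hw.2 hw.1
    rw [← dist_eq_one_iff_adj] at hv hv'
    exact hne (hT.eq_of_dist_add_one_eq (u := c) hw.2 hw'.2 (by omega) (by omega))
  · rw [Finset.disjoint_left]
    intro w hw hw'
    simp only [mem_neighborFinset, mem_biUnion, mem_erase] at hw hw'
    obtain ⟨v, hv, hwc, hvw⟩ := hw'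
    have h2 := hdist v w hv hvw hwc
    rw [← dist_eq_one_iff_adj] at hw
    omega
  · simp only [mem_union, mem_neighborFinset, mem_biUnion, mem_erase]
    rintro (h | ⟨v, -, h, -⟩)
    · exact h.ne rfl
    · exact h rfl

lemma card_neighborFinset_erase {v : V} (hv : T.Adj c v) :
    (#((T.neighborFinset v).erase c) : ℝ) = (deg T v : ℝ) - 1 := by
  have hmem : c ∈ T.neighborFinset v := by simpa using hv.symm
  rw [Finset.cast_card_erase_of_mem hmem, deg_eq_card]

lemma IsTree.card_eq_sum_deg_add_one (hT : T.IsTree) (hc : ∀ v, T.dist c v ≤ 2) :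
    Fintype.card V = ∑ v ∈ T.neighborFinset c, deg T v + 1 := by
  have h := hT.sum_univ_of_dist_le_two hc (fun _ => 1)
  simp only [sum_const, nsmul_eq_mul, mul_one, card_univ] at h
  have h' : ∑ v ∈ T.neighborFinset c, (#((T.neighborFinset v).erase c) : ℝ) =
      ∑ v ∈ T.neighborFinset c, ((deg T v : ℝ) - 1) :=
    sum_congr rfl fun v hv => card_neighborFinset_erase (by simpa using hv)
  rw [h', sum_sub_distrib] at h
  simp only [sum_const, nsmul_eq_mul, mul_one] at h
  have : (Fintype.card V : ℝ) = ((∑ v ∈ T.neighborFinset c, deg T v + 1 : ℕ) : ℝ) := by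
    push_cast
    linarith
  exact_mod_cast this

/-- The index of a tree of radius two with at least two neighbors of the center, all of which are
non-leaves. -/
lemma IsTree.xiAC_eq (hT : T.IsTree) (hd : gdiam T = 4) (hc : ∀ v, T.dist c v ≤ 2)
    (hk : 2 ≤ deg T c) (hdeg : ∀ v, T.Adj c v → 2 ≤ deg T v) :
    xiAC T = ((∏ v ∈ T.neighborFinset c, deg T v : ℕ) : ℝ) / 2 + (deg T c : ℝ) ^ 2 / 3 +
      (∑ v ∈ T.neighborFinset c, (deg T v : ℝ) * (deg T v - 1)) / 4 := by
  have hdist : ∀ v w, T.Adj c v → T.Adj v w → w ≠ c → T.dist c w = 2 := by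
    intro v w hv hw hwc
    have := hT.dist_eq_add_one_of_ne (u := c) hv hw hwc (by simpa using hv)
    rw [this, dist_eq_one_iff_adj.2 hv]
  have hchild : ∀ v, T.Adj c v → ∃ w, T.Adj v w ∧ w ≠ c := by
    intro v hv
    have h2 := hdeg v hv
    rw [deg_eq_card] at h2
    obtain ⟨w, hw, hwc⟩ := Finset.exists_mem_ne h2 c
    exact ⟨w, by simpa using hw, hwc⟩
  have hother : ∀ v, ∃ v', T.Adj c v' ∧ v' ≠ v := by
    intro v
    rw [deg_eq_card] at hk
    obtain ⟨w, hw, hwc⟩ := Finset.exists_mem_ne hk v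
    exact ⟨w, by simpa using hw, hwc⟩
  have hecc_c : ecc T c = 2 := by
    refine le_antisymm (Finset.sup_le fun z _ => hc z) ?_
    obtain ⟨v, hv, -⟩ := hother c
    obtain ⟨w, hw, hwc⟩ := hchild v hv
    rw [← hdist v w hv hw hwc]
    exact dist_le_ecc T c w
  have hecc_v : ∀ v, T.Adj c v → ecc T v = 3 := by
    intro v hv
    refine le_antisymm (Finset.sup_le fun z _ => ?_) ?_
    · have h1 := hT.connected.dist_triangle (u := v) (v := c) (w := z)
      rw [dist_eq_one_iff_adj.2 hv.symm] at h1
      have := hc z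
      omega
    · obtain ⟨v', hv', hne⟩ := hother v
      obtain ⟨w, hw, hwc⟩ := hchild v' hv'
      have h1 := hT.dist_eq_add_one_of_ne (u := v) hv.symm hv' hne (by simpa using hv.symm)
      have h2 := hT.dist_eq_add_one_of_ne hv' hw hwc h1
      have h3 := dist_le_ecc T v w
      rw [dist_eq_one_iff_adj.2 hv.symm] at h1
      omega
  have hecc_w : ∀ v w, T.Adj c v → T.Adj v w → w ≠ c → ecc T w = 4 := by
    intro v x hv hx hxc
    refine le_antisymm (hd ▸ ecc_le_gdiam T x) ?_
    obtain ⟨v', hv', hne⟩ := hother v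
    obtain ⟨w, hw, hwc⟩ := hchild v' hv'
    have h0 := hT.dist_eq_add_one_of_ne (u := x) hx.symm hv.symm hxc.symm (by simpa using hx.symm)
    have h1 := hT.dist_eq_add_one_of_ne hv.symm hv' hne h0
    have h2 := hT.dist_eq_add_one_of_ne hv' hw hwc h1
    have h3 := dist_le_ecc T x w
    rw [dist_eq_one_iff_adj.2 hx.symm] at h0
    omega
  have hnbr_w : ∀ v w, T.Adj c v → T.Adj v w → w ≠ c → T.neighborFinset w = {v} := by
    intro v w hv hw hwc
    have h2 := hdist v w hv hw hwc
    ext y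
    simp only [mem_neighborFinset, mem_singleton]
    refine ⟨fun hy => ?_, fun h => h ▸ hw.symm⟩
    rw [← dist_eq_one_iff_adj] at hv
    by_contra hne
    have h3 := hT.dist_eq_add_one_of_ne hw hy hne (u := c) (by omega)
    have := hc y
    omega
  have hM_w : ∀ v w, T.Adj c v → T.Adj v w → w ≠ c → Mprod T w = deg T v := by
    intro v w hv hw hwc
    rw [Mprod_eq_prod, hnbr_w v w hv hw hwc, prod_singleton]
  have hM_v : ∀ v, T.Adj c v → Mprod T v = deg T c := by
    intro v hv
    have hmem : c ∈ T.neighborFinset v := by simpa using hv.symm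
    rw [Mprod_eq_prod, ← mul_prod_erase _ _ hmem, prod_eq_one, mul_one]
    intro w hw
    simp only [mem_erase, mem_neighborFinset] at hw
    rw [deg_eq_card, hnbr_w v w hv hw.2 hw.1, card_singleton]
  rw [xiAC, hT.sum_univ_of_dist_le_two hc, hecc_c, Mprod_eq_prod]
  have hsum_v : ∑ v ∈ T.neighborFinset c, (Mprod T v : ℝ) / (ecc T v : ℝ) =
      (deg T c : ℝ) ^ 2 / 3 := by
    rw [sum_congr rfl (g := fun _ => (deg T c : ℝ) / 3), sum_const, ← deg_eq_card, nsmul_eq_mul]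
    · ring
    · intro v hv
      rw [mem_neighborFinset] at hv
      rw [hM_v v hv, hecc_v v hv, Nat.cast_ofNat]
  have hsum_w : ∑ v ∈ T.neighborFinset c, ∑ w ∈ (T.neighborFinset v).erase c,
      (Mprod T w : ℝ) / (ecc T w : ℝ) =
      (∑ v ∈ T.neighborFinset c, (deg T v : ℝ) * (deg T v - 1)) / 4 := by
    rw [sum_div]
    refine sum_congr rfl fun v hv => ?_
    rw [mem_neighborFinset] at hv
    rw [sum_congr rfl (g := fun _ => (deg T v : ℝ) / 4), sum_const, nsmul_eq_mul,
      card_neighborFinset_erase hv]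
    · ring
    · intro w hw
      simp only [mem_erase, mem_neighborFinset] at hw
      rw [hM_w v w hv hw.2 hw.1, hecc_w v w hv hw.2 hw.1, Nat.cast_ofNat]
  rw [hsum_v, hsum_w, Nat.cast_ofNat]
  ring

end Center

end SimpleGraph

lemma exists_counts_of_two_or_three {α : Type*} [DecidableEq α] (s : Finset α) (d : α → ℕ)
    (h : ∀ x ∈ s, d x = 2 ∨ d x = 3) :
    ∃ a b : ℕ, a + b = #s ∧ 2 * a + 3 * b = ∑ x ∈ s, d x ∧ ∏ x ∈ s, d x = 2 ^ a * 3 ^ b ∧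
      ∑ x ∈ s, (d x : ℝ) * (d x - 1) = 2 * a + 6 * b := by
  induction s using Finset.induction_on with
  | empty => exact ⟨0, 0, by simp⟩
  | insert x s hx ih =>
    obtain ⟨a, b, h1, h2, h3, h4⟩ := ih fun y hy => h y (mem_insert_of_mem hy)
    rcases h x (mem_insert_self x s) with hd | hd
    · refine ⟨a + 1, b, ?_, ?_, ?_, ?_⟩
      · rw [card_insert_of_notMem hx]; omega
      · rw [sum_insert hx]; omega
      · rw [prod_insert hx, h3, hd]; ring
      · rw [sum_insert hx, h4, hd]; push_cast; ring
    · refine ⟨a, b + 1, ?_, ?_, ?_, ?_⟩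
      · rw [card_insert_of_notMem hx]; omega
      · rw [sum_insert hx]; omega
      · rw [prod_insert hx, h3, hd]; ring
      · rw [sum_insert hx, h4, hd]; push_cast; ring

lemma two_or_three_of_balanced {α : Type*} (s : Finset α) (d : α → ℕ)
    (hbal : ∀ x ∈ s, ∀ y ∈ s, d x ≤ d y + 1) (hlt : 2 * #s < ∑ x ∈ s, d x)
    (hle : ∑ x ∈ s, d x ≤ 3 * #s) (x : α) (hx : x ∈ s) : d x = 2 ∨ d x = 3 := by
  have h1 : 2 ≤ d x := by
    by_contra h
    have : ∑ y ∈ s, d y ≤ #s • 2 :=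
      sum_le_card_nsmul s d 2 fun y hy => by have := hbal y hy x hx; omega
    rw [smul_eq_mul] at this
    omega
  have h2 : d x ≤ 3 := by
    by_contra h
    have := sum_lt_sum (s := s) (f := fun _ => 3) (g := d)
      (fun y hy => by have := hbal x hx y hy; omega) ⟨x, hx, by omega⟩
    rw [sum_const, smul_eq_mul] at this
    omega
  omega

/-- The value of the index for a central vertex with `a` neighbors of degree two and `b` neighbors
of degree three. -/
noncomputable def balancedValue (a b : ℕ) : ℝ :=
  (2 ^ a * 3 ^ b : ℝ) / 2 + ((a + b : ℕ) : ℝ) ^ 2 / 3 + (2 * a + 6 * b) / 4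

lemma IsTB.exists_xiAC_eq_balancedValue {V : Type*} [Fintype V] {T : SimpleGraph V} {n k : ℕ}
    (hTB : IsTB T n k) (hk : 2 ≤ k) (hlt : 2 * k < n - 1) (hle : n - 1 ≤ 3 * k) :
    ∃ a b : ℕ, a + b = k ∧ 2 * a + 3 * b = n - 1 ∧ xiAC T = balancedValue a b := by
  classical
  obtain ⟨hT, hn, hd, c, hcmin, hck, hbal⟩ := hTB
  obtain ⟨m, hm⟩ := hT.exists_ecc_le_two hd
  have hc : ∀ v, T.dist c v ≤ 2 := fun v => (dist_le_ecc T c v).trans ((hcmin m).trans hm)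
  have hcard := hT.card_eq_sum_deg_add_one hc
  have hs : ∑ v ∈ T.neighborFinset c, deg T v = n - 1 := by omega
  have hk' : #(T.neighborFinset c) = k := by rw [← deg_eq_card, hck]
  have h23 := two_or_three_of_balanced (T.neighborFinset c) (deg T)
    (fun x hx y hy => hbal x y (by simpa using hx) (by simpa using hy)) (by omega) (by omega)
  obtain ⟨a, b, h1, h2, h3, h4⟩ := exists_counts_of_two_or_three _ _ h23
  refine ⟨a, b, by omega, by omega, ?_⟩
  rw [hT.xiAC_eq hd hc (by omega)
    (fun v hv => by have := h23 v (by simpa using hv); omega), h3, h4, hck, ← hk', ← h1,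
    balancedValue]
  push_cast
  rfl

lemma balancedValue_lt (a b : ℕ) (hb : 1 ≤ b) :
    balancedValue (a + 3) b < balancedValue a (b + 2) := by
  have h2 : (a : ℝ) + 1 ≤ 2 ^ a := by
    have := one_add_mul_le_pow (a := (1 : ℝ)) (by norm_num) a
    norm_num at this
    linarith
  have h3 : 2 * (b : ℝ) + 1 ≤ 3 ^ b := by
    have := one_add_mul_le_pow (a := (2 : ℝ)) (by norm_num) b
    norm_num at this
    linarith
  have hb' : (1 : ℝ) ≤ b := by exact_mod_cast hb
  have ha' : (0 : ℝ) ≤ a := Nat.cast_nonneg a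
  have hprod : ((a : ℝ) + 1) * (2 * b + 1) ≤ 2 ^ a * 3 ^ b := by gcongr
  have hab : (a : ℝ) ≤ a * b := le_mul_of_one_le_right ha' hb'
  unfold balancedValue
  push_cast
  rw [pow_add, pow_add]
  nlinarith

lemma balancedValue_lt_of_pos (a b j : ℕ) (hb : 1 ≤ b) (hj : 1 ≤ j) :
    balancedValue (a + 3 * j) b < balancedValue a (b + 2 * j) := by
  induction j, hj using Nat.le_induction generalizing b with
  | base => exact balancedValue_lt a b hb
  | succ j _ ih =>
    calc balancedValue (a + 3 * (j + 1)) b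
      _ = balancedValue (a + 3 * j + 3) b := by ring_nf
      _ < balancedValue (a + 3 * j) (b + 2) := balancedValue_lt _ _ hb
      _ < balancedValue a (b + 2 + 2 * j) := ih (b + 2) (by omega)
      _ = balancedValue a (b + 2 * (j + 1)) := by ring_nf

lemma ceilDiv_eq_three {a b : ℕ} (h : ceilDiv a b = 3) : 2 * b < a ∧ a ≤ 3 * b := by
  unfold ceilDiv at h
  rcases Nat.eq_zero_or_pos b with rfl | hb
  · simp at h
  · rw [Nat.div_eq_iff hb] at h
    omega

lemma three_le_of_nonleaf {V : Type*} [Fintype V] {T : SimpleGraph V} {n k : ℕ}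
    (hTB : IsTB T n k)
    (hnonleaf : ∀ c : V, (∀ v, ecc T c ≤ ecc T v) →
      3 ≤ {v | T.Adj c v ∧ deg T v ≠ 1}.ncard) : 3 ≤ k := by
  obtain ⟨-, -, -, c, hc, hk, -⟩ := hTB
  exact (hnonleaf c hc).trans
    (hk ▸ Set.ncard_le_ncard (fun v hv => hv.1) (Set.toFinite {v | T.Adj c v}))

/-- Lemma: Let `T = TB_{n,k}` be a degree balanced tree of diameter 4 whose central vertex
has at least three non-leaf neighbors, with `⌈(n-1)/k⌉ = 3`. Then
`ξ^{ac}(T) ≤ ξ^{ac}(TB_{n,⌈(n-1)/3⌉})`, with equality iff `k = ⌈(n-1)/3⌉`. -/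
theorem xiAC_TB_p3_max (n k : ℕ) {V : Type*} [Fintype V] (T : SimpleGraph V)
    (hTB : IsTB T n k)
    (hnonleaf : ∀ c : V, (∀ v, ecc T c ≤ ecc T v) →
      3 ≤ {v | T.Adj c v ∧ deg T v ≠ 1}.ncard)
    (hp : ceilDiv (n - 1) k = 3)
    {V' : Type*} [Fintype V'] (T₀ : SimpleGraph V')
    (hT₀ : IsTB T₀ n (ceilDiv (n - 1) 3)) :
    xiAC T ≤ xiAC T₀ ∧ (xiAC T = xiAC T₀ ↔ k = ceilDiv (n - 1) 3) := by
  have hk := three_le_of_nonleaf hTB hnonleaf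
  obtain ⟨hlt, hle⟩ := ceilDiv_eq_three hp
  set k₀ := ceilDiv (n - 1) 3 with hk₀
  rw [ceilDiv] at hk₀
  obtain ⟨a, b, h1, h2, h3⟩ := hTB.exists_xiAC_eq_balancedValue (by omega) hlt hle
  obtain ⟨a₀, b₀, h1', h2', h3'⟩ :=
    hT₀.exists_xiAC_eq_balancedValue (by omega) (by omega) (by omega)
  obtain ⟨j, rfl⟩ : ∃ j, k = k₀ + j := Nat.exists_eq_add_of_le (by omega)
  obtain rfl : a = a₀ + 3 * j := by omega
  obtain rfl : b₀ = b + 2 * j := by omega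
  rw [h3, h3']
  rcases Nat.eq_zero_or_pos j with rfl | hj
  · simp
  · have h := balancedValue_lt_of_pos a₀ b j (by omega) hj
    exact ⟨h.le, iff_of_false h.ne (by omega)⟩
end
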